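/- arXiv:2208.00224 — 6 statements merged into one kernel-verified Lean document; each statement's English description precedes it below -/
import Mathlib

section
/- Let d ≥ 2 and let R be a real d×d matrix with all diagonal entries equal to 1 satisfying Assumptions (A1) and (A2). Then for every index i ∈ {1,…,d} there exists an index j ≠ i such that the entry r_{ij} ≠ 0. -/
open Matrix Filter

/-- A real matrix `R` is an S-matrix if there exists a vector `x ≥ 0`
(coordinatewise) with `R.mulVec x > 0` (coordinatewise). -/
def IsSMatrix {n : Type*} [Fintype n] (R : Matrix n n ℝ) : Prop :=
  ∃ x : n → ℝ, (∀ i, 0 ≤ x i) ∧ ∀ i, 0 < R.mulVec x i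

/-- Assumption (A1): `R` is not an S-matrix. -/
def AssumptionA1 {d : ℕ} (R : Matrix (Fin d) (Fin d) ℝ) : Prop :=
  ¬ IsSMatrix R

/-- Assumption (A2): every principal submatrix of `R` indexed by a nonempty
proper subset of `{1,…,d}` is an S-matrix. -/
def AssumptionA2 {d : ℕ} (R : Matrix (Fin d) (Fin d) ℝ) : Prop :=
  ∀ I : Finset (Fin d), I.Nonempty → I ≠ Finset.univ →
    IsSMatrix (R.submatrix (fun i : I => (i : Fin d)) (fun i : I => (i : Fin d)))

theorem stmt_0 {d : ℕ} (hd : 2 ≤ d) (R : Matrix (Fin d) (Fin d) ℝ)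
    (hdiag : ∀ i, R i i = 1) (hA1 : AssumptionA1 R) (hA2 : AssumptionA2 R) :
    ∀ i : Fin d, ∃ j : Fin d, j ≠ i ∧ R i j ≠ 0 := by
  intro i
  by_contra hcon
  push Not at hcon
  apply hA1
  have hne : ∃ k : Fin d, k ≠ i := by
    have : Nontrivial (Fin d) := Fin.nontrivial_iff_two_le.mpr hd
    exact exists_ne i
  obtain ⟨k₀, hk₀⟩ := hne
  obtain ⟨x, hx0, hx⟩ := hA2 (Finset.univ.erase i) ⟨k₀, by simp [hk₀]⟩
    (fun h => by
      have := Finset.mem_univ i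
      rw [← h] at this
      simp at this)
  let X : Fin d → ℝ := fun j => if h : j ∈ Finset.univ.erase i then x ⟨j, h⟩ else 0
  have hX0 : ∀ j, 0 ≤ X j := by
    intro j
    by_cases h : j ∈ Finset.univ.erase i
    · simp only [X, dif_pos h]; exact hx0 _
    · simp only [X, dif_neg h]; exact le_refl _
  have hXi : X i = 0 := by simp [X]
  have hX : ∀ k, k ≠ i → 0 < (R *ᵥ X) k := by
    intro k hk
    have hk' : k ∈ Finset.univ.erase i := by simp [hk]
    have h1 := hx ⟨k, hk'⟩
    have h2 : (R *ᵥ X) k = ∑ j ∈ Finset.univ.erase i, R k j * X j := by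
      rw [Finset.sum_erase _ (by rw [hXi, mul_zero])]
      rfl
    rw [h2, ← Finset.sum_coe_sort]
    refine lt_of_lt_of_eq h1 ?_
    change ∑ j : (Finset.univ.erase i : Finset (Fin d)), R k j * x j = _
    refine Finset.sum_congr rfl fun j _ => ?_
    have hj : X j = x j := by simp only [X, dif_pos j.2]
    rw [hj]
  have hXrow : (R *ᵥ X) i = 0 := by
    change ∑ j, R i j * X j = 0
    refine Finset.sum_eq_zero fun j _ => ?_
    by_cases h : j = i
    · rw [h, hXi, mul_zero]
    · rw [hcon j h, zero_mul]
  have hev : ∀ᶠ M : ℝ in atTop, ∀ k, k ≠ i → 0 < M * (R *ᵥ X) k + R k i := by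
    rw [eventually_all]
    intro k
    by_cases hk : k = i
    · exact Eventually.of_forall fun _ h => absurd hk h
    · have ht : Tendsto (fun M : ℝ => M * (R *ᵥ X) k + R k i) atTop atTop :=
        tendsto_atTop_add_const_right _ _ (tendsto_id.atTop_mul_const (hX k hk))
      filter_upwards [ht.eventually_gt_atTop 0] with M hM _
      exact hM
  obtain ⟨M, hM, hM0⟩ := (hev.and (eventually_ge_atTop 0)).exists
  refine ⟨M • X + Pi.single i 1, fun j => ?_, fun k => ?_⟩
  · have h1 : (0 : ℝ) ≤ (Pi.single i 1 : Fin d → ℝ) j := by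
      by_cases h : j = i
      · subst h; simp
      · simp [h]
    exact add_nonneg (mul_nonneg hM0 (hX0 j)) h1
  · have h : (R *ᵥ (M • X + Pi.single i 1)) k = M * (R *ᵥ X) k + R k i := by
      rw [mulVec_add, mulVec_smul, mulVec_single_one]
      rfl
    rw [h]
    by_cases hk : k = i
    · rw [hk, hXrow, hdiag]; norm_num
    · exact hM k hk
end

section
/- Let d ≥ 2 and let R be a real d×d matrix with all diagonal entries equal to 1 satisfying Assumptions (A1) and (A2), and assume det R = 0. Then the rank of R equals d − 1. -/
open Matrix Filter

/-- Ville's theorem of the alternative. -/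
lemma ville_aux {d : ℕ} (R : Matrix (Fin d) (Fin d) ℝ) (h : ¬ IsSMatrix R) :
    ∃ y : Fin d → ℝ, (∀ i, 0 ≤ y i) ∧ y ≠ 0 ∧ ∀ j, (y ᵥ* R) j ≤ 0 := by
  classical
  let s : Set (Fin d → ℝ) := Set.univ.pi fun _ => Set.Ioi 0
  let t : Set (Fin d → ℝ) := R.mulVecLin '' (Set.Ici 0)
  have hs : Convex ℝ s := convex_pi fun _ _ => convex_Ioi 0
  have hso : IsOpen s := isOpen_set_pi Set.finite_univ fun _ _ => isOpen_Ioi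
  have ht : Convex ℝ t := (convex_Ici (𝕜 := ℝ) (0 : Fin d → ℝ)).linear_image _
  have hst : Disjoint s t := by
    rw [Set.disjoint_left]
    rintro a ha ⟨x, hx, rfl⟩
    exact h ⟨x, fun i => hx i, fun i => ha i (Set.mem_univ i)⟩
  obtain ⟨f, u, hfs, hft⟩ := geometric_hahn_banach_open hs hso ht hst
  have hu : u ≤ 0 := by
    have := hft 0 ⟨0, by simp, by simp⟩
    simpa using this
  have hcone : ∀ x : Fin d → ℝ, 0 ≤ x → 0 ≤ f (R *ᵥ x) := by
    intro x hx
    by_contra! hneg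
    have h1 := hft (R *ᵥ (((u - 1) / f (R *ᵥ x)) • x)) ⟨_, by
      exact smul_nonneg (div_nonneg_of_nonpos (by linarith) hneg.le) hx, rfl⟩
    rw [Matrix.mulVec_smul, map_smul, smul_eq_mul, div_mul_cancel₀ _ hneg.ne] at h1
    linarith
  have hf : ∀ v : Fin d → ℝ, f v = ∑ i, v i * f (Pi.single i 1) := by
    intro v
    conv_lhs => rw [pi_eq_sum_univ' v]
    simp [map_sum]
  refine ⟨fun i => - f (Pi.single i 1), ?_, ?_, ?_⟩
  · intro i
    by_contra! hneg
    have hp : 0 < f (Pi.single i 1) := by linarith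
    set p := f (Pi.single i 1)
    have h1 := hfs (1 + (|f 1| / p) • Pi.single i 1) (by
      intro j _
      have : 0 ≤ (|f 1| / p) * (Pi.single i 1 : Fin d → ℝ) j :=
        mul_nonneg (by positivity) (by by_cases hj : j = i <;> simp [Pi.single_apply, hj])
      simp only [Pi.add_apply, Pi.smul_apply, smul_eq_mul, Pi.one_apply, Set.mem_Ioi]
      linarith)
    rw [map_add, map_smul, smul_eq_mul, div_mul_cancel₀ _ hp.ne'] at h1
    linarith [neg_abs_le (f 1)]
  · intro h0
    have h1 := hfs 1 (by intro j _; simp)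
    rw [hf 1] at h1
    have : ∀ i, f (Pi.single i 1) = 0 := fun i => by simpa using congrFun h0 i
    simp [this] at h1
    linarith
  · intro j
    have h1 := hcone (Pi.single j 1) (by
      intro k; by_cases hj : k = j <;> simp [Pi.single_apply, hj])
    rw [hf] at h1
    simp only [Matrix.vecMul, dotProduct, neg_mul, Finset.sum_neg_distrib]
    simp only [Matrix.mulVec_single_one, Matrix.col_apply] at h1
    simp only [mul_comm] at h1 ⊢
    linarith

lemma full_support_aux {d : ℕ} (R : Matrix (Fin d) (Fin d) ℝ) (hA2 : AssumptionA2 R)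
    (y : Fin d → ℝ) (hy : ∀ i, 0 ≤ y i) (hy0 : y ≠ 0) (hyR : ∀ j, (y ᵥ* R) j ≤ 0) :
    ∀ i, 0 < y i := by
  classical
  by_contra! hcon
  obtain ⟨i, hi⟩ := hcon
  let I : Finset (Fin d) := Finset.univ.filter fun k => 0 < y k
  have hmem : ∀ k, k ∈ I ↔ 0 < y k := fun k => by simp [I]
  obtain ⟨k, hk⟩ := Function.ne_iff.mp hy0
  have hkI : k ∈ I := (hmem k).2 (lt_of_le_of_ne (hy k) (Ne.symm hk))
  obtain ⟨x, hx, hRx⟩ := hA2 I ⟨k, hkI⟩ (by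
    intro h
    have : i ∈ I := h ▸ Finset.mem_univ i
    linarith [(hmem i).1 this])
  have hpos : 0 < ∑ a : I, y a * (∑ b : I, R a b * x b) := by
    apply Finset.sum_pos
    · intro a _
      exact mul_pos ((hmem a).1 a.2) (hRx a)
    · exact ⟨⟨k, hkI⟩, Finset.mem_univ _⟩
  have hcol : ∀ b, ∑ a : I, y a * R a b = (y ᵥ* R) b := by
    intro b
    rw [Finset.sum_coe_sort I (fun a => y a * R a b)]
    apply Finset.sum_subset (Finset.subset_univ _)
    intro a _ ha
    have : y a = 0 := le_antisymm (not_lt.1 fun h => ha ((hmem a).2 h)) (hy a)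
    simp [this]
  have heq : ∑ a : I, y a * (∑ b : I, R a b * x b) = ∑ b : I, (y ᵥ* R) b * x b := by
    simp only [← hcol, Finset.mul_sum, Finset.sum_mul]
    rw [Finset.sum_comm]
    simp only [mul_assoc]
  have : ∑ b : I, (y ᵥ* R) b * x b ≤ 0 :=
    Finset.sum_nonpos fun b _ => mul_nonpos_of_nonpos_of_nonneg (hyR b) (hx b)
  linarith

lemma ker_aux {d : ℕ} (R : Matrix (Fin d) (Fin d) ℝ) (hA2 : AssumptionA2 R)
    (y : Fin d → ℝ) (hy : ∀ i, 0 < y i) (hyR : ∀ j, (y ᵥ* R) j ≤ 0)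
    (z : Fin d → ℝ) (hz : z ᵥ* R = 0) (i : Fin d) (hi : z i < 0) :
    ∃ c : ℝ, c • y = z := by
  obtain ⟨k, -, hk⟩ := Finset.exists_min_image Finset.univ (fun j => z j / y j) ⟨i, Finset.mem_univ i⟩
  have hc : z k / y k < 0 := (hk i (Finset.mem_univ i)).trans_lt (div_neg_of_neg_of_pos hi (hy i))
  refine ⟨z k / y k, ?_⟩
  by_contra hne
  have := full_support_aux R hA2 (z - (z k / y k) • y) (fun j => by
    have := (le_div_iff₀ (hy j)).1 (hk j (Finset.mem_univ j))
    simpa using this) (fun h => hne (sub_eq_zero.1 h).symm) (fun j => by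
    rw [Matrix.sub_vecMul, hz, Matrix.smul_vecMul]
    simpa using mul_nonneg_of_nonpos_of_nonpos hc.le (hyR j)) k
  simp [div_mul_cancel₀ _ (hy k).ne'] at this

theorem stmt_1 {d : ℕ} (hd : 2 ≤ d) (R : Matrix (Fin d) (Fin d) ℝ)
    (hdiag : ∀ i, R i i = 1) (hA1 : AssumptionA1 R) (hA2 : AssumptionA2 R)
    (hdet : R.det = 0) :
    R.rank = d - 1 := by
  obtain ⟨y, hy, hy0, hyR⟩ := ville_aux R hA1
  have hpos := full_support_aux R hA2 y hy hy0 hyR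
  have hker : LinearMap.ker Rᵀ.mulVecLin ≤ Submodule.span ℝ {y} := by
    intro z hz
    have hz : z ᵥ* R = 0 := by simpa [Matrix.mulVec_transpose] using hz
    rw [Submodule.mem_span_singleton]
    by_cases h0 : z = 0
    · exact ⟨0, by simp [h0]⟩
    obtain ⟨i, hi⟩ := Function.ne_iff.mp h0
    rcases lt_or_gt_of_ne hi with hi | hi
    · exact ker_aux R hA2 y hpos hyR z hz i hi
    · obtain ⟨c, hc⟩ := ker_aux R hA2 y hpos hyR (-z) (by simp [Matrix.neg_vecMul, hz]) i
        (by simpa using hi)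
      exact ⟨-c, by rw [neg_smul, hc, neg_neg]⟩
  have h1 : Module.finrank ℝ (LinearMap.ker Rᵀ.mulVecLin) ≤ 1 :=
    (Submodule.finrank_mono hker).trans (finrank_span_singleton hy0).le
  have h2 : 0 < Module.finrank ℝ (LinearMap.ker Rᵀ.mulVecLin) := by
    obtain ⟨v, hv, hvR⟩ := Matrix.exists_vecMul_eq_zero_iff.2 hdet
    rw [Module.finrank_pos_iff_exists_ne_zero]
    exact ⟨⟨v, by simpa [Matrix.mulVec_transpose] using hvR⟩, by simpa using hv⟩
  have h3 := LinearMap.finrank_range_add_finrank_ker Rᵀ.mulVecLin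
  have h4 : Rᵀ.rank = R.rank := Matrix.rank_transpose R
  rw [Matrix.rank] at h4
  simp only [Module.finrank_fin_fun] at h3
  omega
end

section
/- Let d ≥ 2 and let R be a real d×d matrix with all diagonal entries equal to 1 satisfying Assumptions (A1) and (A2), and assume det R = 0. Then there exists a column vector U ∈ ℝ^d with all coordinates strictly positive such that R·U = 0. -/
open Matrix Filter

/-- `R` restricted to `I` is an S-matrix, phrased with vectors supported in `I`. -/
def SOn {n : Type*} [Fintype n] (R : Matrix n n ℝ) (I : Finset n) : Prop :=
  ∃ x : n → ℝ, (∀ i, 0 ≤ x i) ∧ (∀ i, i ∉ I → x i = 0) ∧ ∀ i ∈ I, 0 < R.mulVec x i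

lemma son_ville {n : Type*} [Fintype n] [DecidableEq n] (R : Matrix n n ℝ) (I : Finset n)
    (h : ¬ SOn Rᵀ I) :
    ∃ y : n → ℝ, (∀ i, 0 ≤ y i) ∧ (∀ i, i ∉ I → y i = 0) ∧ y ≠ 0 ∧
      ∀ j ∈ I, R.mulVec y j ≤ 0 := by
  let K : Set (n → ℝ) := {v | ∀ i ∈ I, 0 < v i}
  let T : Set (n → ℝ) :=
    {v | ∃ x : n → ℝ, (∀ i, 0 ≤ x i) ∧ (∀ i, i ∉ I → x i = 0) ∧ v = Rᵀ.mulVec x}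
  have hKo : IsOpen K := by
    have : K = ⋂ i ∈ I, {v : n → ℝ | 0 < v i} := by ext v; simp [K]
    rw [this]
    exact isOpen_biInter_finset fun i _ => isOpen_lt continuous_const (continuous_apply i)
  have hKc : Convex ℝ K := by
    intro a ha b hb s t hs ht hst i hi
    have h1 := ha i hi
    have h2 := hb i hi
    simp only [Pi.add_apply, Pi.smul_apply, smul_eq_mul]
    rcases hs.eq_or_lt with h0 | h0
    · have : t = 1 := by linarith
      subst this; subst h0; simpa using h2
    · have := mul_pos h0 h1
      have := mul_nonneg ht h2.le
      linarith
  have hTc : Convex ℝ T := by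
    rintro a ⟨x, hx, hx', rfl⟩ b ⟨z, hz, hz', rfl⟩ s t hs ht hst
    refine ⟨s • x + t • z, ?_, ?_, ?_⟩
    · intro i
      have := mul_nonneg hs (hx i)
      have := mul_nonneg ht (hz i)
      simp only [Pi.add_apply, Pi.smul_apply, smul_eq_mul]
      linarith
    · intro i hi; simp [hx' i hi, hz' i hi]
    · rw [Matrix.mulVec_add, Matrix.mulVec_smul, Matrix.mulVec_smul]
  have hdis : Disjoint K T := by
    rw [Set.disjoint_left]
    rintro v hv ⟨x, hx, hx', rfl⟩
    exact h ⟨x, hx, hx', hv⟩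
  obtain ⟨f, u, hf1, hf2⟩ := geometric_hahn_banach_open hKc hKo hTc hdis
  have h0 : u ≤ 0 := by
    have := hf2 0 ⟨0, by simp, by simp, by simp⟩
    simpa using this
  have hone : (1 : n → ℝ) ∈ K := by intro i _; simp
  have hrep : ∀ v : n → ℝ, f v = ∑ i, v i * f (Pi.single i 1) := by
    intro v
    conv_lhs => rw [pi_eq_sum_univ' v]
    simp
  have hle : ∀ i, f (Pi.single i 1) ≤ 0 := by
    intro i
    by_contra! hc
    have hm : (1 : n → ℝ) + (|f 1| / f (Pi.single i 1)) • Pi.single i 1 ∈ K := by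
      intro j _
      have : 0 ≤ |f 1| / f (Pi.single i 1) := by positivity
      by_cases hj : j = i
      · subst hj; simp; linarith
      · simp [hj]
    have := hf1 _ hm
    rw [map_add, map_smul, smul_eq_mul, div_mul_cancel₀ _ hc.ne'] at this
    have := neg_abs_le (f 1)
    linarith
  have hge : ∀ i, i ∉ I → 0 ≤ f (Pi.single i 1) := by
    intro i hi
    by_contra! hc
    have hm : (1 : n → ℝ) + (|f 1| / f (Pi.single i 1)) • Pi.single i 1 ∈ K := by
      intro j hj
      have hj : j ≠ i := fun e => hi (e ▸ hj)
      simp [hj]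
    have := hf1 _ hm
    rw [map_add, map_smul, smul_eq_mul, div_mul_cancel₀ _ hc.ne] at this
    have := neg_abs_le (f 1)
    linarith
  refine ⟨fun i => - f (Pi.single i 1), fun i => by linarith [hle i],
    fun i hi => by linarith [hle i, hge i hi], ?_, ?_⟩
  · intro hy
    have h1 := hf1 _ hone
    have : f 1 = 0 := by
      rw [hrep]
      apply Finset.sum_eq_zero
      intro i _
      have := congrFun hy i
      simp only [Pi.zero_apply, neg_eq_zero] at this
      simp [this]
    linarith
  · intro j hj
    have key : R.mulVec (fun i => - f (Pi.single i 1)) j = - f (Rᵀ.mulVec (Pi.single j 1)) := by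
      rw [hrep]
      simp [Matrix.mulVec, dotProduct, Pi.single_apply]
    rw [key]
    by_contra! hc
    set a := f (Rᵀ.mulVec (Pi.single j 1)) with ha
    have ha0 : a < 0 := by linarith
    have hs : 0 ≤ (u - 1) / a := div_nonneg_of_nonpos (by linarith) ha0.le
    have := hf2 (Rᵀ.mulVec (((u - 1) / a) • Pi.single j 1)) ⟨_, ?_, ?_, rfl⟩
    · rw [Matrix.mulVec_smul, map_smul, ← ha, smul_eq_mul, div_mul_cancel₀ _ ha0.ne] at this
      linarith
    · intro i
      by_cases hi : i = j
      · subst hi; simpa using hs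
      · simp [hi]
    · intro i hi
      have hi : i ≠ j := fun e => hi (e ▸ hj)
      simp [hi]

lemma son_zero {n : Type*} [Fintype n] (R : Matrix n n ℝ) (J : Finset n)
    (h : SOn Rᵀ J) (w : n → ℝ) (hw : ∀ i, 0 ≤ w i) (hw' : ∀ i, i ∉ J → w i = 0)
    (hR : ∀ i ∈ J, R.mulVec w i ≤ 0) : w = 0 := by
  obtain ⟨v, hv, hv', hp⟩ := h
  have e : ∑ i, v i * R.mulVec w i = ∑ j, w j * Rᵀ.mulVec v j := by
    simp only [Matrix.mulVec, dotProduct, Finset.mul_sum, Matrix.transpose_apply]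
    rw [Finset.sum_comm]
    refine Finset.sum_congr rfl fun i _ => Finset.sum_congr rfl fun j _ => by ring
  have l : ∑ i, v i * R.mulVec w i ≤ 0 := by
    apply Finset.sum_nonpos
    intro i _
    by_cases hi : i ∈ J
    · exact mul_nonpos_of_nonneg_of_nonpos (hv i) (hR i hi)
    · simp [hv' i hi]
  have nn : ∀ j ∈ Finset.univ, 0 ≤ w j * Rᵀ.mulVec v j := by
    intro j _
    by_cases hj : j ∈ J
    · exact mul_nonneg (hw j) (hp j hj).le
    · simp [hw' j hj]
  have z := (Finset.sum_eq_zero_iff_of_nonneg nn).1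
    (le_antisymm (e ▸ l) (Finset.sum_nonneg nn))
  funext j
  by_cases hj : j ∈ J
  · exact (mul_eq_zero.1 (z j (Finset.mem_univ j))).resolve_right (hp j hj).ne'
  · exact hw' j hj

lemma exists_ratio {n : Type*} (I : Finset n) (hI : I.Nonempty) (x z : n → ℝ)
    (hx : ∀ i ∈ I, 0 < x i) : ∃ k ∈ I, (∀ i ∈ I, z i / x i ≤ z k / x k) ∧
      (∀ i ∈ I, 0 ≤ z k / x k * x i - z i) ∧ z k / x k * x k - z k = 0 := by
  obtain ⟨k, hk, hm⟩ := I.exists_max_image (fun i => z i / x i) hI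
  refine ⟨k, hk, hm, fun i hi => ?_, ?_⟩
  · have := (div_le_iff₀ (hx i hi)).1 (hm i hi)
    linarith
  · rw [div_mul_cancel₀ _ (hx k hk).ne', sub_self]

lemma son_transpose {n : Type*} [Fintype n] [DecidableEq n] (R : Matrix n n ℝ) (I : Finset n)
    (h : ∀ J ⊆ I, J.Nonempty → SOn R J) : SOn Rᵀ I := by
  induction I using Finset.strongInduction with
  | H I ih =>
  by_contra hc
  obtain ⟨x, hx, hx', hx0, hR⟩ := son_ville R I hc
  have ih' : ∀ k ∈ I, SOn Rᵀ (I.erase k) := fun k hk =>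
    ih _ (Finset.erase_ssubset hk) fun J hJ => h J (hJ.trans (Finset.erase_subset _ _))
  have hpos : ∀ k ∈ I, 0 < x k := by
    intro k hk
    refine lt_of_le_of_ne (hx k) fun e => hx0 ?_
    refine son_zero R _ (ih' k hk) x hx ?_ fun i hi => hR i (Finset.mem_of_mem_erase hi)
    intro i hi
    by_cases hik : i = k
    · rw [hik, ← e]
    · exact hx' i fun hI => hi (Finset.mem_erase.2 ⟨hik, hI⟩)
  have hne : I.Nonempty := by
    rw [Finset.nonempty_iff_ne_empty]
    rintro rfl
    exact hx0 (funext fun i => hx' i (by simp))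
  obtain ⟨z, hz, hz', hzp⟩ := h I subset_rfl hne
  obtain ⟨k, hk, -, hw, hwk⟩ := exists_ratio I hne x z hpos
  set t := z k / x k
  have ht : 0 ≤ t := div_nonneg (hz k) (hx k)
  have hneg : ∀ i ∈ I, R.mulVec (t • x - z) i < 0 := by
    intro i hi
    rw [Matrix.mulVec_sub, Matrix.mulVec_smul]
    have := mul_nonpos_of_nonneg_of_nonpos ht (hR i hi)
    have := hzp i hi
    simp only [Pi.sub_apply, Pi.smul_apply, smul_eq_mul]
    linarith
  have w0 : t • x - z = 0 := by
    refine son_zero R _ (ih' k hk) _ ?_ ?_ fun i hi => (hneg i (Finset.mem_of_mem_erase hi)).le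
    · intro i
      by_cases hi : i ∈ I
      · simpa using hw i hi
      · simp [hx' i hi, hz' i hi]
    · intro i hi
      by_cases hik : i = k
      · subst hik; simpa using hwk
      · have : i ∉ I := fun hI => hi (Finset.mem_erase.2 ⟨hik, hI⟩)
        simp [hx' i this, hz' i this]
  have := hneg k hk
  rw [w0] at this
  simp at this

lemma son_of_submatrix {d : ℕ} (R : Matrix (Fin d) (Fin d) ℝ) (I : Finset (Fin d))
    (h : IsSMatrix (R.submatrix (fun i : I => (i : Fin d)) (fun i : I => (i : Fin d)))) :
    SOn R I := by
  obtain ⟨x, hx, hp⟩ := h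
  refine ⟨fun i => if hi : i ∈ I then x ⟨i, hi⟩ else 0, ?_, ?_, ?_⟩
  · intro i
    by_cases hi : i ∈ I
    · simpa [hi] using hx ⟨i, hi⟩
    · simp [hi]
  · intro i hi; simp [hi]
  · intro i hi
    have := hp ⟨i, hi⟩
    convert this using 1
    simp only [Matrix.mulVec, dotProduct, Matrix.submatrix_apply]
    rw [← Finset.sum_subset (Finset.subset_univ I), ← Finset.sum_coe_sort I]
    · refine Finset.sum_congr rfl fun j _ => ?_
      simp
    · intro j _ hj; simp [hj]

theorem stmt_2 {d : ℕ} (hd : 2 ≤ d) (R : Matrix (Fin d) (Fin d) ℝ)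
    (hdiag : ∀ i, R i i = 1) (hA1 : AssumptionA1 R) (hA2 : AssumptionA2 R)
    (hdet : R.det = 0) :
    ∃ U : Fin d → ℝ, (∀ i, 0 < U i) ∧ R.mulVec U = 0 := by
  have hS : ∀ J : Finset (Fin d), J.Nonempty → J ≠ Finset.univ → SOn R J :=
    fun J h1 h2 => son_of_submatrix R J (hA2 J h1 h2)
  have hT : ∀ J : Finset (Fin d), J ≠ Finset.univ → SOn Rᵀ J := by
    intro J hJ
    refine son_transpose R J fun J' hs hn => hS J' hn ?_
    rintro rfl
    exact hJ (Finset.univ_subset_iff.1 hs)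
  have hnT : ¬ SOn Rᵀ Finset.univ := by
    intro hu
    have : SOn Rᵀᵀ Finset.univ := by
      refine son_transpose Rᵀ _ fun J _ _ => ?_
      by_cases hJ : J = Finset.univ
      · rw [hJ]; exact hu
      · exact hT J hJ
    rw [Matrix.transpose_transpose] at this
    obtain ⟨x, hx, -, hp⟩ := this
    exact hA1 ⟨x, hx, fun i => hp i (Finset.mem_univ i)⟩
  obtain ⟨x, hx, -, hx0, hR⟩ := son_ville R _ hnT
  have hz : ∀ w : Fin d → ℝ, (∀ i, 0 ≤ w i) → (∀ i, R.mulVec w i ≤ 0) → ∀ k, w k = 0 → w = 0 := by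
    intro w hw hRw k hk
    refine son_zero R (Finset.univ.erase k) (hT _ ?_) w hw ?_ fun i _ => hRw i
    · exact (Finset.erase_ssubset (Finset.mem_univ k)).ne
    · intro i hi
      have : i = k := by simpa using hi
      rw [this, hk]
  have hR' : ∀ i, R.mulVec x i ≤ 0 := fun i => hR i (Finset.mem_univ i)
  have hpos : ∀ i, 0 < x i := fun i =>
    lt_of_le_of_ne (hx i) fun e => hx0 (hz x hx hR' i e.symm)
  obtain ⟨u, ⟨i, hi⟩, hu⟩ : ∃ u : Fin d → ℝ, (∃ i, 0 < u i) ∧ R.mulVec u = 0 := by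
    obtain ⟨u, hu0, hu⟩ := Matrix.exists_mulVec_eq_zero_iff.2 hdet
    obtain ⟨i, hi⟩ := Function.ne_iff.1 hu0
    rcases lt_or_gt_of_ne hi with h | h
    · exact ⟨-u, ⟨i, by simpa using h⟩, by rw [Matrix.mulVec_neg, hu, neg_zero]⟩
    · exact ⟨u, ⟨i, h⟩, hu⟩
  obtain ⟨k, -, hm, hw, hwk⟩ := exists_ratio Finset.univ ⟨i, Finset.mem_univ i⟩ x u
    fun i _ => hpos i
  have ht : 0 < u k / x k := lt_of_lt_of_le (div_pos hi (hpos i)) (hm i (Finset.mem_univ i))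
  set t := u k / x k
  have w0 : t • x - u = 0 := by
    refine hz _ (fun i => by simpa using hw i (Finset.mem_univ i)) ?_ k (by simpa using hwk)
    intro i
    rw [Matrix.mulVec_sub, Matrix.mulVec_smul, hu]
    simpa using mul_nonpos_of_nonneg_of_nonpos ht.le (hR' i)
  refine ⟨x, hpos, ?_⟩
  have : t • R.mulVec x = 0 := by
    rw [← Matrix.mulVec_smul, sub_eq_zero.1 w0, hu]
  exact (smul_eq_zero.1 this).resolve_left ht.ne'
end

section
/- Let d ≥ 2 and let R be a real d×d matrix with all diagonal entries equal to 1 satisfying Assumptions (A1) and (A2). Then for every index j ∈ {1,…,d} there exists a vector X ∈ ℝ^d with all coordinates ≥ 0 such that the j-th coordinate of R·X equals −1 and the i-th coordinate of R·X is strictly positive for every i ≠ j. -/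
open Matrix Filter

theorem stmt_4 {d : ℕ} (hd : 2 ≤ d) (R : Matrix (Fin d) (Fin d) ℝ)
    (hdiag : ∀ i, R i i = 1) (hA1 : AssumptionA1 R) (hA2 : AssumptionA2 R) :
    ∀ j : Fin d, ∃ X : Fin d → ℝ, (∀ i, 0 ≤ X i) ∧
      R.mulVec X j = -1 ∧ ∀ i : Fin d, i ≠ j → 0 < R.mulVec X i := by
  intro j
  obtain ⟨x, hx0, hx⟩ := hA2 (Finset.univ.erase j) (by
      have : Nontrivial (Fin d) := Fin.nontrivial_iff_two_le.mpr hd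
      obtain ⟨k, hk⟩ := exists_ne j
      exact ⟨k, by simp [hk]⟩) (by
      intro h
      have := Finset.mem_univ j
      rw [← h] at this
      simp at this)
  obtain ⟨y, hy⟩ : ∃ y : Fin d → ℝ, y = fun i =>
      if h : i ∈ Finset.univ.erase j then x ⟨i, h⟩ else 0 := ⟨_, rfl⟩
  have hy0 : ∀ i, 0 ≤ y i := by
    intro i
    rw [hy]
    dsimp only
    split_ifs with h
    · exact hx0 _
    · exact le_rfl
  have hyj : y j = 0 := by simp [hy]
  have hyp : ∀ i, i ≠ j → 0 < R.mulVec y i := by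
    intro i hi
    have h1 := hx ⟨i, by simp [hi]⟩
    have h2 : R.mulVec y i = ∑ k ∈ Finset.univ.erase j, R i k * y k := by
      rw [Finset.sum_erase _ (by rw [hyj, mul_zero])]
      rfl
    rw [h2, ← Finset.sum_coe_sort]
    convert h1 using 1
    simp only [Matrix.mulVec, dotProduct, Matrix.submatrix_apply]
    refine Finset.sum_congr rfl fun k _ => ?_
    have hk : y k = x k := by
      rw [hy]
      dsimp only
      rw [dif_pos k.2]
    rw [hk]
  have hneg : R.mulVec y j < 0 := by
    by_contra! hc
    have hev : ∀ᶠ t : ℝ in nhdsWithin 0 (Set.Ioi 0),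
        ∀ i, i ≠ j → 0 < R.mulVec y i + t * R i j := by
      apply Filter.Eventually.filter_mono nhdsWithin_le_nhds
      rw [Filter.eventually_all]
      intro i
      by_cases hi : i = j
      · simp [hi]
      · have hcont : ContinuousAt (fun t : ℝ => R.mulVec y i + t * R i j) 0 := by fun_prop
        have := hcont.eventually (lt_mem_nhds (a := 0) (by simpa using hyp i hi))
        filter_upwards [this] with t ht _ using ht
    obtain ⟨t, ht, ht0⟩ := (hev.and self_mem_nhdsWithin).exists
    have ht0' : 0 < t := ht0
    apply hA1
    have hm : ∀ i, R.mulVec (y + Pi.single j t) i = R.mulVec y i + t * R i j := by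
      intro i
      rw [Matrix.mulVec_add, Pi.add_apply]
      simp [mul_comm]
    refine ⟨y + Pi.single j t, fun i => ?_, fun i => ?_⟩
    · have : (0 : Fin d → ℝ) ≤ Pi.single j t := Pi.single_nonneg.mpr ht0'.le
      exact add_nonneg (hy0 i) (this i)
    · rw [hm]
      by_cases hi : i = j
      · subst hi
        rw [hdiag]
        linarith
      · exact ht i hi
  have hc : 0 < (-(R.mulVec y j))⁻¹ := inv_pos.mpr (by linarith)
  refine ⟨(-(R.mulVec y j))⁻¹ • y, fun i => mul_nonneg hc.le (hy0 i), ?_, fun i hi => ?_⟩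
  · rw [Matrix.mulVec_smul, Pi.smul_apply, smul_eq_mul]
    have := hneg.ne
    field_simp
  · rw [Matrix.mulVec_smul, Pi.smul_apply, smul_eq_mul]
    exact mul_pos hc (hyp i hi)
end

section
/- Let d ≥ 2, let R be a real d×d matrix with all diagonal entries equal to 1 satisfying Assumptions (A1) and (A2), and assume det R = 0. Let Σ be a symmetric positive definite real d×d matrix and let μ ∈ ℝ^d have all coordinates strictly positive. Then there exists a unique nonzero vector a ∈ ℝ^d such that a·R = 0 (as a row vector, i.e., Rᵀ·a = 0) and ⟨a, Σ·a⟩ + ⟨a, μ⟩ = 0; moreover, all coordinates of this vector a are strictly negative. -/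
open Matrix Filter

lemma aux_ville {d : ℕ} (hd : 2 ≤ d) (R : Matrix (Fin d) (Fin d) ℝ) (hA1 : AssumptionA1 R) :
    ∃ y : Fin d → ℝ, (∀ i, 0 ≤ y i) ∧ y ≠ 0 ∧ ∀ j, Rᵀ.mulVec y j ≤ 0 := by
  let s : Set (Fin d → ℝ) := Set.pi Set.univ (fun _ => Set.Ioi 0)
  let t : Set (Fin d → ℝ) := Set.image R.mulVecLin (Set.pi Set.univ (fun _ => Set.Ici 0))
  have hs : Convex ℝ s := convex_pi (fun _ _ => convex_Ioi 0)
  have hso : IsOpen s := isOpen_set_pi Set.finite_univ (fun _ _ => isOpen_Ioi)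
  have ht : Convex ℝ t := (convex_pi (fun _ _ => convex_Ici 0)).linear_image _
  have hdis : Disjoint s t := by
    rw [Set.disjoint_left]
    rintro v hv ⟨x, hx, rfl⟩
    exact hA1 ⟨x, fun i => hx i trivial, fun i => hv i trivial⟩
  obtain ⟨f, u, h1, h2⟩ := geometric_hahn_banach_open hs hso ht hdis
  have hu : u ≤ 0 := by
    have := h2 0 ⟨0, fun i _ => by simp, by simp⟩
    simpa using this
  have hf : ∀ v : Fin d → ℝ, f v = ∑ i, v i * f (Pi.single i 1) := by
    intro v
    conv_lhs => rw [pi_eq_sum_univ' v]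
    rw [map_sum]
    refine Finset.sum_congr rfl fun i _ => ?_
    rw [map_smul, smul_eq_mul]
  refine ⟨fun i => - f (Pi.single i 1), ?_, ?_, ?_⟩
  · intro i
    by_contra hneg
    push Not at hneg
    have hc : 0 < f (Pi.single i 1) := by linarith
    set c := f (Pi.single i 1) with hcdef
    set g := f (fun _ => 1) with hg
    have hpos : 0 < c / (|g| + 1) := by positivity
    have := h1 (Pi.single i 1 + (c / (|g| + 1)) • (fun _ => 1)) (by
      intro j _
      have : (0:ℝ) ≤ (Pi.single i 1 : Fin d → ℝ) j := by
        rw [Pi.single_apply]; split_ifs <;> norm_num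
      simp only [Pi.add_apply, Pi.smul_apply, smul_eq_mul, mul_one, Set.mem_Ioi]
      linarith)
    rw [map_add, map_smul, smul_eq_mul, ← hcdef, ← hg] at this
    have h3 : c / (|g| + 1) * (|g| + 1) = c := by field_simp
    nlinarith [neg_abs_le g]
  · intro h0
    have h3 := h1 (fun _ => 1) (fun i _ => by simp)
    rw [hf] at h3
    have : ∀ i, f (Pi.single i 1) = 0 := fun i => by
      have := congrFun h0 i
      simpa using this
    simp [this] at h3
    linarith
  · intro j
    have key : Rᵀ.mulVec (fun i => - f (Pi.single i 1)) j = - f (R.mulVec (Pi.single j 1)) := by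
      rw [hf (R.mulVec _)]
      simp [Matrix.mulVec, dotProduct, Pi.single_apply]
    rw [key]
    by_contra hneg
    push Not at hneg
    set c := f (R.mulVec (Pi.single j 1)) with hc
    have hc0 : c < 0 := by linarith
    have h4 : 0 ≤ u / c := div_nonneg_of_nonpos hu hc0.le
    have := h2 _ ⟨(u / c + 1) • Pi.single j 1, (by
      intro k _
      have : (0:ℝ) ≤ (Pi.single j 1 : Fin d → ℝ) k := by
        rw [Pi.single_apply]; split_ifs <;> norm_num
      simp only [Pi.smul_apply, smul_eq_mul, Set.mem_Ici]
      positivity), rfl⟩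
    rw [map_smul, map_smul, smul_eq_mul, Matrix.mulVecLin_apply, ← hc] at this
    have h5 : u / c * c = u := div_mul_cancel₀ _ hc0.ne
    nlinarith

lemma aux_pos {d : ℕ} (R : Matrix (Fin d) (Fin d) ℝ) (hA2 : AssumptionA2 R)
    (y : Fin d → ℝ) (hy : ∀ i, 0 ≤ y i) (hy0 : y ≠ 0) (hR : ∀ j, Rᵀ.mulVec y j ≤ 0) :
    ∀ i, 0 < y i := by
  by_contra hcon
  push Not at hcon
  obtain ⟨k, hk⟩ := hcon
  obtain ⟨l, hl⟩ := Function.ne_iff.mp hy0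
  have hl' : 0 < y l := lt_of_le_of_ne (hy l) (Ne.symm hl)
  set I : Finset (Fin d) := Finset.univ.filter (fun i => 0 < y i) with hI
  obtain ⟨x, hx, hRx⟩ := hA2 I ⟨l, by simp [hI, hl']⟩ (by
    intro h
    have : k ∈ I := h ▸ Finset.mem_univ k
    simp [hI] at this
    linarith)
  have e1 : 0 < ∑ i : I, y i * ((R.submatrix (fun i : I => (i : Fin d))
      (fun i : I => (i : Fin d))).mulVec x i) := by
    refine Finset.sum_pos (fun i _ => mul_pos ?_ (hRx i)) ⟨⟨l, by simp [hI, hl']⟩, Finset.mem_univ _⟩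
    exact (Finset.mem_filter.mp i.2).2
  have e2 : ∑ i : I, y i * ((R.submatrix (fun i : I => (i : Fin d))
      (fun i : I => (i : Fin d))).mulVec x i) = ∑ j : I, Rᵀ.mulVec y j * x j := by
    simp only [Matrix.mulVec, dotProduct, Matrix.submatrix_apply, Matrix.transpose_apply,
      Finset.mul_sum]
    rw [Finset.sum_comm]
    refine Finset.sum_congr rfl fun j _ => ?_
    have : ∑ i, R i j * y i = ∑ i : I, R i j * y i := by
      rw [Finset.sum_coe_sort I (fun i => R i j * y i)]
      symm
      apply Finset.sum_subset (Finset.subset_univ _)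
      intro i _ hi
      have h0 : y i = 0 := le_antisymm (by simpa [hI] using hi) (hy i)
      simp [h0]
    rw [this, Finset.sum_mul]
    exact Finset.sum_congr rfl fun i _ => by ring
  have e3 : ∑ j : I, Rᵀ.mulVec y j * x j ≤ 0 :=
    Finset.sum_nonpos fun j _ => mul_nonpos_of_nonpos_of_nonneg (hR j) (hx j)
  linarith

lemma aux_neg {d : ℕ} (R : Matrix (Fin d) (Fin d) ℝ) (hA2 : AssumptionA2 R)
    (y : Fin d → ℝ) (hy : ∀ i, 0 < y i) (hR : ∀ j, Rᵀ.mulVec y j ≤ 0)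
    (z : Fin d → ℝ) (hz : Rᵀ.mulVec z = 0) (k : Fin d) (hk : z k < 0) :
    ∃ m : ℝ, m < 0 ∧ z = m • y := by
  obtain ⟨i, -, hi⟩ := Finset.exists_min_image Finset.univ (fun i => z i / y i) ⟨k, Finset.mem_univ k⟩
  have hm : z i / y i < 0 := lt_of_le_of_lt (hi k (Finset.mem_univ k)) (div_neg_of_neg_of_pos hk (hy k))
  refine ⟨z i / y i, hm, ?_⟩
  by_contra hne
  have := aux_pos R hA2 (z - (z i / y i) • y) (fun j => by
      have h := hi j (Finset.mem_univ j)
      have h2 := (le_div_iff₀ (hy j)).mp h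
      simp only [Pi.sub_apply, Pi.smul_apply, smul_eq_mul]
      linarith) (sub_ne_zero.mpr hne) (fun j => by
      rw [Matrix.mulVec_sub, Matrix.mulVec_smul, hz]
      simp only [Pi.sub_apply, Pi.smul_apply, smul_eq_mul, Pi.zero_apply]
      nlinarith [hR j]) i
  simp [div_mul_cancel₀ _ (hy i).ne'] at this

lemma aux_ker {d : ℕ} (R : Matrix (Fin d) (Fin d) ℝ) (hA2 : AssumptionA2 R)
    (y : Fin d → ℝ) (hy : ∀ i, 0 < y i) (hR : ∀ j, Rᵀ.mulVec y j ≤ 0)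
    (z : Fin d → ℝ) (hz : Rᵀ.mulVec z = 0) (hz0 : z ≠ 0) :
    ∃ m : ℝ, m ≠ 0 ∧ z = m • y := by
  obtain ⟨k, hk⟩ := Function.ne_iff.mp hz0
  rcases lt_or_gt_of_ne hk with h | h
  · obtain ⟨m, hm, e⟩ := aux_neg R hA2 y hy hR z hz k h
    exact ⟨m, hm.ne, e⟩
  · obtain ⟨m, hm, e⟩ := aux_neg R hA2 y hy hR (-z) (by rw [Matrix.mulVec_neg, hz, neg_zero]) k
      (by simpa using h)
    exact ⟨-m, by simpa using hm.ne, by rw [neg_smul, ← e, neg_neg]⟩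

theorem stmt_6 {d : ℕ} (hd : 2 ≤ d) (R : Matrix (Fin d) (Fin d) ℝ)
    (hdiag : ∀ i, R i i = 1) (hA1 : AssumptionA1 R) (hA2 : AssumptionA2 R)
    (hdet : R.det = 0)
    (S : Matrix (Fin d) (Fin d) ℝ) (hsymm : S.IsSymm) (hpd : S.PosDef)
    (μ : Fin d → ℝ) (hμ : ∀ i, 0 < μ i) :
    (∃! a : Fin d → ℝ, a ≠ 0 ∧ Rᵀ.mulVec a = 0 ∧
        a ⬝ᵥ S.mulVec a + a ⬝ᵥ μ = 0) ∧
    ∀ a : Fin d → ℝ, (a ≠ 0 ∧ Rᵀ.mulVec a = 0 ∧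
        a ⬝ᵥ S.mulVec a + a ⬝ᵥ μ = 0) → ∀ i, a i < 0 := by
  obtain ⟨y, hy, hy0, hR⟩ := aux_ville hd R hA1
  have hyp := aux_pos R hA2 y hy hy0 hR
  obtain ⟨z, hz0, hz⟩ := Matrix.exists_mulVec_eq_zero_iff.mpr ((Matrix.det_transpose R).trans hdet)
  have hker := aux_ker R hA2 y hyp hR
  have hRy : Rᵀ.mulVec y = 0 := by
    obtain ⟨m, hm, e⟩ := hker z hz hz0
    rw [e, Matrix.mulVec_smul] at hz
    exact (smul_eq_zero.mp hz).resolve_left hm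
  have hq : 0 < y ⬝ᵥ S.mulVec y := by
    have := hpd.dotProduct_mulVec_pos hy0
    simpa using this
  have hl : 0 < y ⬝ᵥ μ := by
    haveI : NeZero d := ⟨by omega⟩
    exact Finset.sum_pos (fun i _ => mul_pos (hyp i) (hμ i)) ⟨0, Finset.mem_univ _⟩
  have hval : ∀ c : ℝ, (c • y) ⬝ᵥ S.mulVec (c • y) + (c • y) ⬝ᵥ μ
      = c * (c * (y ⬝ᵥ S.mulVec y) + y ⬝ᵥ μ) := by
    intro c
    simp only [Matrix.mulVec_smul, smul_dotProduct, dotProduct_smul, smul_eq_mul]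
    ring
  have hneg : -(y ⬝ᵥ μ) / (y ⬝ᵥ S.mulVec y) < 0 := div_neg_of_neg_of_pos (by linarith) hq
  have huniq : ∀ a : Fin d → ℝ, (a ≠ 0 ∧ Rᵀ.mulVec a = 0 ∧
        a ⬝ᵥ S.mulVec a + a ⬝ᵥ μ = 0) → a = (-(y ⬝ᵥ μ) / (y ⬝ᵥ S.mulVec y)) • y := by
    rintro a ⟨ha0, haR, hae⟩
    obtain ⟨m, hm, rfl⟩ := hker a haR ha0
    rw [hval] at hae
    have h := (mul_eq_zero.mp hae).resolve_left hm
    congr 1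
    rw [eq_div_iff hq.ne']
    linarith
  refine ⟨⟨_, ⟨smul_ne_zero hneg.ne hy0, ?_, ?_⟩, huniq⟩, ?_⟩
  · rw [Matrix.mulVec_smul, hRy, smul_zero]
  · rw [hval, div_mul_cancel₀ _ hq.ne']
    ring
  · intro a ha i
    rw [huniq a ha]
    exact mul_neg_of_neg_of_pos hneg (hyp i)
end

section
/- Let d ≥ 1, let R = (r_{ij}) be a real d×d matrix, let a ∈ ℝ^d be a nonzero vector, and let f : ℝ^d → ℝ be defined by f(x) = exp(⟨a, x⟩). Suppose that for every i ∈ {1,…,d} and every x in the orthant ℝ₊^d with x_i = 0 one has ∑_k r_{ki} ∂f/∂x_k (x) = 0. Then Rᵀ·a = 0 and consequently det R = 0. -/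
open Matrix Filter

theorem stmt_10 {d : ℕ} (hd : 1 ≤ d) (R : Matrix (Fin d) (Fin d) ℝ)
    (a : Fin d → ℝ) (ha : a ≠ 0)
    (f : (Fin d → ℝ) → ℝ) (hf : f = fun x => Real.exp (∑ i, a i * x i))
    (hNeu : ∀ i : Fin d, ∀ x : Fin d → ℝ, (∀ k, 0 ≤ x k) → x i = 0 →
      ∑ k, R k i * fderiv ℝ f x (Pi.single k 1) = 0) :
    Rᵀ.mulVec a = 0 ∧ R.det = 0 := by
  have hL : HasFDerivAt (fun x : Fin d → ℝ => ∑ i, a i * x i)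
      (∑ i, a i • (ContinuousLinearMap.proj i : (Fin d → ℝ) →L[ℝ] ℝ)) 0 := by
    apply HasFDerivAt.fun_sum
    intro i _
    exact (hasFDerivAt_apply (𝕜 := ℝ) i (0 : Fin d → ℝ)).const_mul (a i)
  have hfd : ∀ k, fderiv ℝ f 0 (Pi.single k 1) = a k := by
    intro k
    rw [hf, hL.exp.fderiv]
    simp [Pi.single_apply]
  have h0 : Rᵀ.mulVec a = 0 := by
    funext i
    have h := hNeu i 0 (fun _ => le_refl _) rfl
    simp only [hfd] at h
    simpa [Matrix.mulVec, dotProduct] using h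
  refine ⟨h0, ?_⟩
  rw [← Matrix.det_transpose]
  exact Matrix.exists_mulVec_eq_zero_iff.mp ⟨a, ha, h0⟩
end
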